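/- Let a > 1/2 and for u ∈ [−a,a] define f(u) = ∫_{{t ∈ [−a,a] : |t − u| ≥ 1}} log|t − u| / (π√(a² − t²)) dt. Then the maximum of f over [−a,a] is attained at the endpoints u = a and u = −a, and equals ∫_{1−a}^{a} log(t + a)/(π√(a² − t²)) dt. -/

import Mathlib

/-- The function `f(u) = ∫_{t ∈ [-a,a], |t-u| ≥ 1} log|t-u|/(π √(a² - t²)) dt`. -/
noncomputable def equilibriumLogInt (a u : ℝ) : ℝ :=
  ∫ t in {t : ℝ | t ∈ Set.Icc (-a) a ∧ 1 ≤ |t - u|},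
    Real.log |t - u| / (Real.pi * Real.sqrt (a ^ 2 - t ^ 2))

open Real MeasureTheory Set

/-- The substitution `t = a cos θ` rewrites the integral in terms of the continuous function
`log⁺`. -/
theorem equilibriumLogInt_eq_integral_posLog {a : ℝ} (ha : 0 < a) (u : ℝ) :
    equilibriumLogInt a u = π⁻¹ * ∫ θ in 0..π, log⁺ (a * cos θ - u) := by
  have hmeas : MeasurableSet {t : ℝ | 1 ≤ |t - u|} :=
    measurableSet_le measurable_const (by fun_prop)
  have himage : (fun θ => a * cos θ) '' Ioo 0 π = Ioo (-a) a := by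
    ext t
    constructor
    · rintro ⟨θ, ⟨h0, hπ⟩, rfl⟩
      have h1 : cos θ < 1 := by
        simpa using strictAntiOn_cos (left_mem_Icc.2 pi_pos.le) ⟨h0.le, hπ.le⟩ h0
      have h2 : -1 < cos θ := by
        simpa using strictAntiOn_cos ⟨h0.le, hπ.le⟩ (right_mem_Icc.2 pi_pos.le) hπ
      constructor <;> dsimp only <;> nlinarith
    · rintro ⟨h1, h2⟩
      have h3 : -1 < t / a := by rw [lt_div_iff₀ ha]; linarith
      have h4 : t / a < 1 := by rw [div_lt_iff₀ ha]; linarith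
      refine ⟨arccos (t / a), ⟨arccos_pos.2 h4, ?_⟩, ?_⟩
      · refine (arccos_le_pi _).lt_of_ne fun h => ?_
        exact absurd (arccos_eq_pi.1 h) (not_le.2 h3)
      · simp only [cos_arccos h3.le h4.le]
        field_simp
  have hinj : InjOn (fun θ => a * cos θ) (Ioo 0 π) := fun x hx y hy h =>
    injOn_cos (Ioo_subset_Icc_self hx) (Ioo_subset_Icc_self hy) (mul_left_cancel₀ ha.ne' h)
  have hderiv : ∀ θ ∈ Ioo 0 π,
      HasDerivWithinAt (fun θ => a * cos θ) (a * -sin θ) (Ioo 0 π) θ :=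
    fun θ _ => ((hasDerivAt_cos θ).const_mul a).hasDerivWithinAt
  have hindicator : equilibriumLogInt a u =
      ∫ t in Ioo (-a) a, log⁺ (t - u) / (π * √(a ^ 2 - t ^ 2)) := by
    rw [← integral_Icc_eq_integral_Ioo]
    have hset : {t : ℝ | t ∈ Icc (-a) a ∧ 1 ≤ |t - u|} = Icc (-a) a ∩ {t | 1 ≤ |t - u|} := rfl
    rw [equilibriumLogInt, hset, ← setIntegral_indicator hmeas]
    congr 1 with t
    by_cases h : 1 ≤ |t - u|
    · rw [indicator_of_mem (by exact h), ← posLog_abs, posLog_eq_log (by rwa [abs_abs])]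
    · rw [indicator_of_notMem (by exact h),
        (posLog_eq_zero_iff (t - u)).2 (not_le.1 h).le, zero_div]
  rw [hindicator, ← himage,
    integral_image_eq_integral_abs_deriv_smul measurableSet_Ioo hderiv hinj,
    intervalIntegral.integral_of_le pi_pos.le, integral_Ioc_eq_integral_Ioo,
    ← integral_const_mul]
  refine setIntegral_congr_fun measurableSet_Ioo fun θ hθ => ?_
  have hsin : 0 < sin θ := sin_pos_of_mem_Ioo hθ
  have hsqrt : √(a ^ 2 - (a * cos θ) ^ 2) = a * sin θ := by
    rw [← sqrt_sq (mul_pos ha hsin).le]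
    congr 1
    linear_combination (-a ^ 2) * sin_sq_add_cos_sq θ
  have habs : |a * -sin θ| = a * sin θ := by
    rw [mul_neg, abs_neg, abs_of_pos (mul_pos ha hsin)]
  simp only [hsqrt, habs, smul_eq_mul]
  field_simp

theorem two_mul_posLog_mul_cos_sub_le (a θ φ : ℝ) :
    2 * log⁺ (a * cos θ - a * cos φ) ≤
      log⁺ (a * cos (θ + φ) - a) + log⁺ (a * cos (θ - φ) - a) := by
  have hsq : (a * cos θ - a * cos φ) ^ 2 =
      (a * cos (θ + φ) - a) * (a * cos (θ - φ) - a) := by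
    rw [cos_add, cos_sub]
    linear_combination (a ^ 2 * (1 - cos φ ^ 2)) * sin_sq_add_cos_sq θ
      + (a ^ 2 * sin θ ^ 2) * sin_sq_add_cos_sq φ
  have hpow := posLog_pow 2 (a * cos θ - a * cos φ)
  push_cast at hpow
  rw [← hpow, hsq]
  exact posLog_mul

theorem integral_posLog_mul_cos_sub_le (a φ : ℝ) :
    ∫ θ in 0..π, log⁺ (a * cos θ - a * cos φ) ≤ ∫ θ in 0..π, log⁺ (a * cos θ - a) := by
  set g : ℝ → ℝ := fun θ => log⁺ (a * cos θ - a) with hg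
  have hcont : Continuous g := by fun_prop
  have hint (x y : ℝ) : IntervalIntegrable g volume x y := hcont.intervalIntegrable x y
  have heven (θ : ℝ) : g (-θ) = g θ := by simp [hg]
  have hper : Function.Periodic g (2 * π) := fun θ => by simp [hg]
  have hle : ∫ θ in 0..π, 2 * log⁺ (a * cos θ - a * cos φ) ≤
      ∫ θ in 0..π, (g (θ + φ) + g (θ - φ)) :=
    intervalIntegral.integral_mono_on pi_pos.le
      (Continuous.intervalIntegrable (by fun_prop) _ _)
      (Continuous.intervalIntegrable (by fun_prop) _ _)
      fun θ _ => two_mul_posLog_mul_cos_sub_le a θ φ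
  have hreflect (x y : ℝ) : ∫ θ in x..y, g θ = ∫ θ in -y..-x, g θ := by
    rw [← intervalIntegral.integral_comp_neg]
    simp only [heven]
  have hadd : ∫ θ in 0..π, (g (θ + φ) + g (θ - φ)) = ∫ θ in (φ - π)..(φ - π + 2 * π), g θ := by
    rw [intervalIntegral.integral_add (Continuous.intervalIntegrable (by fun_prop) _ _)
      (Continuous.intervalIntegrable (by fun_prop) _ _),
      intervalIntegral.integral_comp_add_right, intervalIntegral.integral_comp_sub_right,
      hreflect (0 - φ), add_comm,
      show -(π - φ) = φ - π by ring, show -(0 - φ) = 0 + φ by ring,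
      intervalIntegral.integral_add_adjacent_intervals (hint _ _) (hint _ _)]
    congr 1
    ring
  have hdouble : ∫ θ in (-π)..(-π + 2 * π), g θ = 2 * ∫ θ in 0..π, g θ := by
    rw [show -π + 2 * π = π by ring,
      ← intervalIntegral.integral_add_adjacent_intervals (hint _ 0) (hint _ _), hreflect (-π),
      neg_neg, neg_zero, two_mul]
  rw [hadd, hper.intervalIntegral_add_eq (φ - π) (-π), hdouble,
    intervalIntegral.integral_const_mul] at hle
  linarith

/-- For `a > 1/2`, the maximum of `f` over `[-a,a]` is attained at the endpoints
`u = a` and `u = -a`, and equals `∫_{1-a}^{a} log(t+a)/(π √(a² - t²)) dt`. -/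
theorem equilibriumLogInt_max_at_endpoints (a : ℝ) (ha : 1 / 2 < a) :
    (∀ u ∈ Set.Icc (-a) a, equilibriumLogInt a u ≤ equilibriumLogInt a a) ∧
    equilibriumLogInt a (-a) = equilibriumLogInt a a ∧
    equilibriumLogInt a a =
      ∫ t in (1 - a)..a, Real.log (t + a) / (Real.pi * Real.sqrt (a ^ 2 - t ^ 2)) := by
  have ha0 : 0 < a := by linarith
  have hsymm : equilibriumLogInt a (-a) = equilibriumLogInt a a := by
    rw [equilibriumLogInt_eq_integral_posLog ha0, equilibriumLogInt_eq_integral_posLog ha0]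
    have hflip := intervalIntegral.integral_comp_sub_left
      (fun θ => log⁺ (a * cos θ - a)) π (a := 0) (b := π)
    rw [sub_self, sub_zero] at hflip
    rw [← hflip]
    congr 2 with θ
    rw [cos_pi_sub, ← posLog_neg]
    congr 1
    ring
  refine ⟨fun u ⟨hu1, hu2⟩ => ?_, hsymm, ?_⟩
  · have hu : u = a * cos (arccos (u / a)) := by
      rw [cos_arccos (by rw [le_div_iff₀ ha0]; linarith) (by rw [div_le_iff₀ ha0]; linarith)]
      field_simp
    rw [equilibriumLogInt_eq_integral_posLog ha0, equilibriumLogInt_eq_integral_posLog ha0, hu]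
    exact mul_le_mul_of_nonneg_left (integral_posLog_mul_cos_sub_le a _) (inv_nonneg.2 pi_pos.le)
  · have hset : {t : ℝ | t ∈ Icc (-a) a ∧ 1 ≤ |t - -a|} = Icc (1 - a) a := by
      ext t
      simp only [mem_ofPred_eq, mem_Icc, sub_neg_eq_add]
      constructor
      · rintro ⟨⟨h1, h2⟩, h3⟩
        rw [abs_of_nonneg (by linarith)] at h3
        exact ⟨by linarith, h2⟩
      · rintro ⟨h1, h2⟩
        exact ⟨⟨by linarith, h2⟩, le_abs.2 (Or.inl (by linarith))⟩
    rw [← hsymm, equilibriumLogInt, hset, intervalIntegral.integral_of_le (by linarith),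
      integral_Icc_eq_integral_Ioc]
    simp only [sub_neg_eq_add, log_abs]
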